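/- Let G and H be premotive games over a poset A (with the identification of games over A×1 with games over A). Then G+* ≤ H if and only if G ≤ H+*. -/

import Mathlib

/-- Games over a poset `α`: atomic games `[a]` for `a : α`, and composite games
`⟨L|R⟩` given by nonempty families of left and right options. -/
inductive Game (α : Type) : Type 1 where
  | atom : α → Game α
  | comp : (ι κ : Type) → (ι → Game α) → (κ → Game α) → Nonempty ι → Nonempty κ → Game α

namespace Game

variable {α β : Type}

/-- `G'` is a left option of the game. -/
def IsLeftOption (G' : Game α) : Game α → Prop
  | atom _ => False
  | comp _ _ L _ _ _ => ∃ i, L i = G'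

/-- `G'` is a right option of the game. -/
def IsRightOption (G' : Game α) : Game α → Prop
  | atom _ => False
  | comp _ _ _ R _ _ => ∃ k, R k = G'

/-- `G'` is an option of `G`. -/
def IsOption (G' G : Game α) : Prop := IsLeftOption G' G ∨ IsRightOption G' G

/-- A game is composite if it is not atomic. -/
def IsComposite : Game α → Prop
  | atom _ => False
  | comp _ _ _ _ _ _ => True

/-- `G'` is a follower of `G`: `G` itself, an option of `G`, or recursively a follower
of an option of `G`. -/
def IsFollower (G' G : Game α) : Prop := Relation.ReflTransGen IsOption G' G

/-- The dual game: Left and Right switch sides; it is a game over the opposite poset. -/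
def dual : Game α → Game αᵒᵈ
  | atom a => atom (OrderDual.toDual a)
  | comp ι κ L R hι hκ => comp κ ι (fun k => (R k).dual) (fun i => (L i).dual) hκ hι

/-- The image of a game under a (monotone) function applied to atoms. -/
def map (f : α → β) : Game α → Game β
  | atom a => atom (f a)
  | comp ι κ L R hι hκ => comp ι κ (fun i => (L i).map f) (fun k => (R k).map f) hι hκ

/-- The (disjunctive) sum of a game over `α` and a game over `β`, a game over `α × β`. -/
noncomputable def add : Game α → Game β → Game (α × β) := by
  intro G
  induction G with
  | atom g =>
    intro H
    induction H with
    | atom h => exact atom (g, h)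
    | comp ι κ L R hι hκ IHL IHR => exact comp ι κ IHL IHR hι hκ
  | comp ι κ L R hι hκ IHL IHR =>
    intro H
    induction H with
    | atom h => exact comp ι κ (fun i => IHL i (atom h)) (fun k => IHR k (atom h)) hι hκ
    | comp ι' κ' L' R' hι' hκ' IHL' IHR' =>
      exact comp (ι ⊕ ι') (κ ⊕ κ')
        (Sum.elim (fun i => IHL i (comp ι' κ' L' R' hι' hκ')) IHL')
        (Sum.elim (fun k => IHR k (comp ι' κ' L' R' hι' hκ')) IHR')
        (hι.elim fun i => ⟨Sum.inl i⟩) (hκ.elim fun k => ⟨Sum.inl k⟩)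

mutual
/-- Left has a first player winning strategy in a game over the boolean poset:
either the game is the atom `⊤`, or some left option has a second player
winning strategy for Left. -/
inductive LeftWinsFirst : Game Bool → Prop where
  | atom_top : LeftWinsFirst (atom true)
  | move {G G' : Game Bool} : IsLeftOption G' G → LeftWinsSecond G' → LeftWinsFirst G

/-- Left has a second player winning strategy in a game over the boolean poset:
every right option has a first player winning strategy for Left, and if the game
is atomic it is the atom `⊤`. -/
inductive LeftWinsSecond : Game Bool → Prop where
  | mk {G : Game Bool} : (∀ G', IsRightOption G' G → LeftWinsFirst G') →
      (∀ b, G = atom b → b = true) → LeftWinsSecond G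
end

mutual
/-- A game is even if all of its options are odd (atomic games are even). -/
inductive Even {α : Type} : Game α → Prop where
  | mk {G : Game α} : (∀ G', IsOption G' G → Odd G') → Even G

/-- A game is odd if it is composite and all of its options are even. -/
inductive Odd {α : Type} : Game α → Prop where
  | mk {G : Game α} : G.IsComposite → (∀ G', IsOption G' G → Even G') → Odd G
end

/-- A game has parity if it is even or odd. -/
def HasParity (G : Game α) : Prop := Even G ∨ Odd G

/-- `G` and `H` have matching parity (both even or both odd). -/
def MatchingParity (G H : Game α) : Prop := (Even G ∧ Even H) ∨ (Odd G ∧ Odd H)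

/-- `G` and `H` have mismatching parity (one even, the other odd). -/
def MismatchParity (G H : Game α) : Prop := (Even G ∧ Odd H) ∨ (Odd G ∧ Even H)

mutual
/-- The intrinsic order `G ≤ H` on games over a poset: every left option `G^L` of `G`
satisfies `G^L ◁ H`, every right option `H^R` of `H` satisfies `G ◁ H^R`, and if
both games are atoms `[g]`, `[h]` then `g ≤ h`. -/
inductive Le {α : Type} [PartialOrder α] : Game α → Game α → Prop where
  | mk {G H : Game α} :
      (∀ G', IsLeftOption G' G → Tri G' H) →
      (∀ H', IsRightOption H' H → Tri G H') →
      (∀ g h, G = atom g → H = atom h → g ≤ h) →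
      Le G H

/-- The intrinsic relation `G ◁ H` on games over a poset: some right option `G^R` of `G`
satisfies `G^R ≤ H`, or some left option `H^L` of `H` satisfies `G ≤ H^L`. -/
inductive Tri {α : Type} [PartialOrder α] : Game α → Game α → Prop where
  | inr {G H G' : Game α} : IsRightOption G' G → Le G' H → Tri G H
  | inl {G H H' : Game α} : IsLeftOption H' H → Le G H' → Tri G H
end

/-- The comparison game `λ(Gᵒᵖ + H)`, a game over the boolean poset, where
`λ : αᵒᵈ × α → 𝔹` is the monotone map with `λ(xᵒᵖ, y) = ⊤` iff `x ≤ y`. -/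
noncomputable def comparison [PartialOrder α] (G H : Game α) : Game Bool :=
  map (fun p : αᵒᵈ × α => @decide (OrderDual.ofDual p.1 ≤ p.2) (Classical.propDecidable _))
    (G.dual.add H)

/-- A game is locally premotive if Left has a first player winning strategy in
the comparison game `λ(Gᵒᵖ + G)`. -/
def LocallyPremotive [PartialOrder α] (G : Game α) : Prop := LeftWinsFirst (comparison G G)

/-- A game is premotive if it and all of its followers are locally premotive. -/
def Premotive [PartialOrder α] (G : Game α) : Prop :=
  ∀ G', IsFollower G' G → LocallyPremotive G'

/-- The game `* = ⟨0|0⟩` over the one-element poset. -/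
def star : Game Unit := comp Unit Unit (fun _ => atom ()) (fun _ => atom ()) ⟨()⟩ ⟨()⟩

/-- `G + *`, identified with a game over `α` via the isomorphism `α × 1 ≅ α`. -/
noncomputable def addStar (G : Game α) : Game α := map Prod.fst (G.add star)

/-- A game is locally `*`-antimonotone if `G^L + * ≤ G ≤ G^R + *` for all left and
right options `G^L`, `G^R`. -/
def LocallyStarAnti [PartialOrder α] (G : Game α) : Prop :=
  (∀ G', IsLeftOption G' G → Le G'.addStar G) ∧ (∀ G', IsRightOption G' G → Le G G'.addStar)

/-- A game is `*`-antimonotone if it and all of its followers are locally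
`*`-antimonotone. -/
def StarAnti [PartialOrder α] (G : Game α) : Prop :=
  ∀ G', IsFollower G' G → LocallyStarAnti G'

/-- `ε(G + X)`: the game `G` over `α` embedded in a context `X`, a game over the poset
`[α, 𝔹]` of monotone functions `α → 𝔹`, via the application map `ε(a, f) = f a`. -/
noncomputable def ctxSum [PartialOrder α] (G : Game α) (X : Game (α →o Bool)) : Game Bool :=
  map (fun p : α × (α →o Bool) => p.2 p.1) (G.add X)

/-- The outcome `(o_L(G), o_R(G)) ∈ 𝔹 × 𝔹` of a game over the boolean poset:
`o_L(G) = ⊤` iff Left has a first player winning strategy and `o_R(G) = ⊤` iff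
Left has a second player winning strategy. -/
noncomputable def outcome (G : Game Bool) : Bool × Bool :=
  (@decide (LeftWinsFirst G) (Classical.propDecidable _),
   @decide (LeftWinsSecond G) (Classical.propDecidable _))

/-- The contextual order `G ≤_c H`: `o(G+X) ≤ o(H+X)` for every context `X`. -/
def ContextualLe [PartialOrder α] (G H : Game α) : Prop :=
  ∀ X : Game (α →o Bool), outcome (ctxSum G X) ≤ outcome (ctxSum H X)

/-- The contextual relation `G ◁_c H`: `o_R(G+X) ≤ o_L(H+X)` for every context `X`. -/
def ContextualTri [PartialOrder α] (G H : Game α) : Prop :=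
  ∀ X : Game (α →o Bool), (outcome (ctxSum G X)).2 ≤ (outcome (ctxSum H X)).1

/-- Two games are identical when they are equal as set-based games: both are the same
atom, or both are composite with identical sets of left options and identical sets of
right options (recursively). -/
def Identical : Game α → Game α → Prop
  | atom a, atom b => a = b
  | comp _ _ L R _ _, comp _ _ L' R' _ _ =>
      ((∀ i, ∃ i', Identical (L i) (L' i')) ∧ (∀ i', ∃ i, Identical (L i) (L' i'))) ∧
      ((∀ k, ∃ k', Identical (R k) (R' k')) ∧ (∀ k', ∃ k, Identical (R k) (R' k')))
  | _, _ => False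

theorem map_fst_add_atom (G : Game α) (u : Unit) : map Prod.fst (G.add (atom u)) = G := by
  induction G with
  | atom g => rfl
  | comp ι κ L R hι hκ IHL IHR =>
    change comp ι κ (fun i => map Prod.fst ((L i).add (atom u)))
      (fun k => map Prod.fst ((R k).add (atom u))) hι hκ = _
    simp only [IHL, IHR]

theorem isLeftOption_addStar (X G : Game α) :
    IsLeftOption X (addStar G) ↔ X = G ∨ ∃ G', IsLeftOption G' G ∧ X = addStar G' := by
  cases G with
  | atom g =>
    change (∃ _ : Unit, atom g = X) ↔ _
    simp [IsLeftOption, eq_comm]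
  | comp ι κ L R hι hκ =>
    have h : ∀ u, map Prod.fst ((comp ι κ L R hι hκ).add (atom u)) = comp ι κ L R hι hκ :=
      fun u => map_fst_add_atom _ u
    constructor
    · rintro ⟨i | u, rfl⟩
      · exact Or.inr ⟨L i, ⟨i, rfl⟩, rfl⟩
      · exact Or.inl (h ())
    · rintro (rfl | ⟨G', ⟨i, rfl⟩, rfl⟩)
      · exact ⟨Sum.inr (), h ()⟩
      · exact ⟨Sum.inl i, rfl⟩

theorem isRightOption_addStar (X G : Game α) :
    IsRightOption X (addStar G) ↔ X = G ∨ ∃ G', IsRightOption G' G ∧ X = addStar G' := by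
  cases G with
  | atom g =>
    change (∃ _ : Unit, atom g = X) ↔ _
    simp [IsRightOption, eq_comm]
  | comp ι κ L R hι hκ =>
    have h : ∀ u, map Prod.fst ((comp ι κ L R hι hκ).add (atom u)) = comp ι κ L R hι hκ :=
      fun u => map_fst_add_atom _ u
    constructor
    · rintro ⟨i | u, rfl⟩
      · exact Or.inr ⟨R i, ⟨i, rfl⟩, rfl⟩
      · exact Or.inl (h ())
    · rintro (rfl | ⟨G', ⟨i, rfl⟩, rfl⟩)
      · exact ⟨Sum.inr (), h ()⟩
      · exact ⟨Sum.inl i, rfl⟩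

theorem addStar_ne_atom (G : Game α) (a : α) : addStar G ≠ atom a := by
  intro h
  have := (isLeftOption_addStar G G).2 (Or.inl rfl)
  rw [h] at this
  exact this

theorem le_iff [PartialOrder α] (G H : Game α) : Le G H ↔
    (∀ G', IsLeftOption G' G → Tri G' H) ∧ (∀ H', IsRightOption H' H → Tri G H') ∧
      (∀ g h, G = atom g → H = atom h → g ≤ h) :=
  ⟨fun h => by cases h with | mk a b c => exact ⟨a, b, c⟩, fun h => .mk h.1 h.2.1 h.2.2⟩

theorem tri_iff [PartialOrder α] (G H : Game α) : Tri G H ↔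
    (∃ G', IsRightOption G' G ∧ Le G' H) ∨ (∃ H', IsLeftOption H' H ∧ Le G H') :=
  ⟨fun h => by
    cases h with
    | inr a b => exact Or.inl ⟨_, a, b⟩
    | inl a b => exact Or.inr ⟨_, a, b⟩,
   fun h => by
    rcases h with ⟨_, a, b⟩ | ⟨_, a, b⟩
    · exact .inr a b
    · exact .inl a b⟩

/-- One inductive step: the two comparisons have the same options. -/
theorem star_step [PartialOrder α] (G H : Game α)
    (h1 : ∀ G', IsOption G' G →
      (Le (addStar G') H ↔ Le G' (addStar H)) ∧ (Tri (addStar G') H ↔ Tri G' (addStar H)))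
    (h2 : ∀ H', IsOption H' H →
      (Le (addStar G) H' ↔ Le G (addStar H')) ∧ (Tri (addStar G) H' ↔ Tri G (addStar H'))) :
    (Le (addStar G) H ↔ Le G (addStar H)) ∧ (Tri (addStar G) H ↔ Tri G (addStar H)) := by
  constructor
  · rw [le_iff, le_iff G]
    constructor
    · rintro ⟨a, b, -⟩
      refine ⟨fun G' hG' => ?_, fun X hX => ?_, fun g h _ e => (addStar_ne_atom _ _ e).elim⟩
      · exact (h1 G' (Or.inl hG')).2.1
          (a _ ((isLeftOption_addStar _ _).2 (Or.inr ⟨G', hG', rfl⟩)))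
      · rcases (isRightOption_addStar _ _).1 hX with rfl | ⟨H', hH', rfl⟩
        · exact a _ ((isLeftOption_addStar _ _).2 (Or.inl rfl))
        · exact (h2 H' (Or.inr hH')).2.1 (b _ hH')
    · rintro ⟨a, b, -⟩
      refine ⟨fun X hX => ?_, fun H' hH' => ?_, fun g h e _ => (addStar_ne_atom _ _ e).elim⟩
      · rcases (isLeftOption_addStar _ _).1 hX with rfl | ⟨G', hG', rfl⟩
        · exact b _ ((isRightOption_addStar _ _).2 (Or.inl rfl))
        · exact (h1 G' (Or.inl hG')).2.2 (a _ hG')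
      · exact (h2 H' (Or.inr hH')).2.2
          (b _ ((isRightOption_addStar _ _).2 (Or.inr ⟨H', hH', rfl⟩)))
  · rw [tri_iff, tri_iff G]
    constructor
    · rintro (⟨X, hX, hl⟩ | ⟨H', hH', hl⟩)
      · rcases (isRightOption_addStar _ _).1 hX with rfl | ⟨G', hG', rfl⟩
        · exact Or.inr ⟨_, (isLeftOption_addStar _ _).2 (Or.inl rfl), hl⟩
        · exact Or.inl ⟨_, hG', (h1 G' (Or.inr hG')).1.1 hl⟩
      · exact Or.inr ⟨_, (isLeftOption_addStar _ _).2 (Or.inr ⟨H', hH', rfl⟩),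
          (h2 H' (Or.inl hH')).1.1 hl⟩
    · rintro (⟨G', hG', hl⟩ | ⟨X, hX, hl⟩)
      · exact Or.inl ⟨_, (isRightOption_addStar _ _).2 (Or.inr ⟨G', hG', rfl⟩),
          (h1 G' (Or.inr hG')).1.2 hl⟩
      · rcases (isLeftOption_addStar _ _).1 hX with rfl | ⟨H', hH', rfl⟩
        · exact Or.inl ⟨_, (isRightOption_addStar _ _).2 (Or.inl rfl), hl⟩
        · exact Or.inr ⟨_, hH', (h2 H' (Or.inl hH')).1.2 hl⟩

theorem isOption_wf : WellFounded (IsOption (α := α)) := by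
  refine ⟨fun G => ?_⟩
  induction G with
  | atom a => exact ⟨_, fun y hy => (hy.elim id id : False).elim⟩
  | comp ι κ L R hι hκ IHL IHR =>
    refine ⟨_, ?_⟩
    rintro y (⟨i, rfl⟩ | ⟨k, rfl⟩)
    · exact IHL i
    · exact IHR k

theorem star_cancellation_aux [PartialOrder α] (G H : Game α) :
    (Le (addStar G) H ↔ Le G (addStar H)) ∧ (Tri (addStar G) H ↔ Tri G (addStar H)) := by
  induction G using isOption_wf.induction generalizing H with
  | _ G ihG =>
    induction H using isOption_wf.induction with
    | _ H ihH => exact star_step G H (fun G' h => ihG G' h H) ihH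

/-- For premotive games, `G + * ≤ H` iff `G ≤ H + *`. -/
theorem star_cancellation {α : Type} [PartialOrder α] (G H : Game α)
    (hG : Premotive G) (hH : Premotive H) :
    Le (addStar G) H ↔ Le G (addStar H) :=
  (star_cancellation_aux G H).1

end Game
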